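/- arXiv:2505.08045 — 3 statements merged into one kernel-verified Lean document; each statement's English description precedes it below -/
import Mathlib

section
/- Let m ≥ 2 and let 1 ≤ i, r ≤ m−1. Then ∫₀¹ B'_{i,m}(u) B'_{r,m}(u) du = [C(m,i)·C(m,r) / ((2m−3)·C(2m−4, i+r−2))] · [ i·r − 2m(m−1)·C(i+r, 2) / ((2m−1)(2m−2)) ], where B'_{i,m} denotes the derivative of the Bernstein basis polynomial B_{i,m} and C(a,b) denotes the binomial coefficient. -/
open MeasureTheory

/-- The Bernstein basis polynomial `B_{i,m}(u) = C(m,i) u^i (1-u)^(m-i)`. -/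
noncomputable def bern (m i : ℕ) (u : ℝ) : ℝ :=
  (m.choose i : ℝ) * u ^ i * (1 - u) ^ (m - i)

/-- The Beta integral at natural parameters. -/
theorem integral_pow_mul_one_sub_pow (a b : ℕ) :
    ∫ u in (0:ℝ)..1, u ^ a * (1 - u) ^ b
      = (a.factorial : ℝ) * b.factorial / (a + b + 1).factorial := by
  induction b generalizing a with
  | zero =>
    have ha : (a.factorial : ℝ) ≠ 0 := by positivity
    have ha' : (a : ℝ) + 1 ≠ 0 := by positivity
    simp [integral_pow, Nat.factorial_succ]
    field_simp
  | succ b ih =>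
    have hderiv : ∀ u : ℝ, HasDerivAt (fun u : ℝ => u ^ (a + 1) * (1 - u) ^ (b + 1))
        (((a : ℝ) + 1) * (u ^ a * (1 - u) ^ (b + 1))
          - ((b : ℝ) + 1) * (u ^ (a + 1) * (1 - u) ^ b)) u := by
      intro u
      refine ((hasDerivAt_pow (a + 1) u).mul
        (((hasDerivAt_id u).const_sub 1).pow (b + 1))).congr_deriv ?_
      simp
      ring
    have hftc := intervalIntegral.integral_eq_sub_of_hasDerivAt (a := 0) (b := 1) (fun u _ => hderiv u)
      (Continuous.intervalIntegrable (by fun_prop) _ _)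
    rw [intervalIntegral.integral_sub (Continuous.intervalIntegrable (by fun_prop) _ _)
      (Continuous.intervalIntegrable (by fun_prop) _ _), intervalIntegral.integral_const_mul,
      intervalIntegral.integral_const_mul, ih] at hftc
    have ha : (a : ℝ) + 1 ≠ 0 := by positivity
    have hidx : a + 1 + b + 1 = a + (b + 1) + 1 := by ring
    rw [hidx] at hftc
    have hf : ((a + (b + 1) + 1).factorial : ℝ) ≠ 0 := by positivity
    apply mul_left_cancel₀ ha
    simp only [Nat.factorial_succ a, Nat.factorial_succ b] at hftc ⊢
    push_cast at hftc ⊢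
    simp at hftc
    linear_combination hftc

theorem integral_pow_succ_mul_one_sub_pow (a b : ℕ) :
    ∫ u in (0:ℝ)..1, u ^ (a + 1) * (1 - u) ^ b
      = ((a : ℝ) + 1) / (a + b + 2) * ∫ u in (0:ℝ)..1, u ^ a * (1 - u) ^ b := by
  have hidx : a + 1 + b + 1 = (a + b + 1) + 1 := by ring
  have hf : ((a + b + 1).factorial : ℝ) ≠ 0 := by positivity
  have hab : (a : ℝ) + b + 2 ≠ 0 := by positivity
  have hab' : (a : ℝ) + b + 1 + 1 ≠ 0 := by positivity
  rw [integral_pow_mul_one_sub_pow, integral_pow_mul_one_sub_pow, hidx,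
    Nat.factorial_succ (a + b + 1), Nat.factorial_succ a]
  push_cast
  field_simp
  ring

theorem integral_pow_mul_one_sub_pow_eq_inv_choose (a b : ℕ) :
    ∫ u in (0:ℝ)..1, u ^ a * (1 - u) ^ b
      = 1 / (((a : ℝ) + b + 1) * ((a + b).choose a : ℝ)) := by
  have hchoose : ((a + b).choose a : ℝ) * a.factorial * b.factorial = (a + b).factorial := by
    have h := Nat.choose_mul_factorial_mul_factorial (Nat.le_add_right a b)
    rw [Nat.add_sub_cancel_left] at h
    exact_mod_cast h
  have hc : ((a + b).choose a : ℝ) ≠ 0 := by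
    exact_mod_cast (Nat.choose_pos (Nat.le_add_right a b)).ne'
  have ha : (a.factorial : ℝ) ≠ 0 := by positivity
  have hb : (b.factorial : ℝ) ≠ 0 := by positivity
  have hab : (a : ℝ) + b + 1 ≠ 0 := by positivity
  rw [integral_pow_mul_one_sub_pow, Nat.factorial_succ]
  push_cast
  rw [← hchoose]
  field_simp

theorem deriv_bern_of_eq {m p k : ℕ} (h : m = p + k + 2) (u : ℝ) :
    deriv (bern m (p + 1)) u
      = (m.choose (p + 1) : ℝ) * (u ^ p * (1 - u) ^ k * ((p : ℝ) + 1 - m * u)) := by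
  have hsub : m - (p + 1) = k + 1 := by omega
  have hm : (m : ℝ) = p + k + 2 := by exact_mod_cast h
  have hd := ((hasDerivAt_pow (p + 1) u).const_mul (m.choose (p + 1) : ℝ)).mul
    (((hasDerivAt_id u).const_sub 1).pow (k + 1))
  have hb : bern m (p + 1) = (fun u : ℝ => (m.choose (p + 1) : ℝ) * u ^ (p + 1)) *
      (fun u : ℝ => 1 - id u) ^ (k + 1) := by
    funext u
    simp [bern, hsub]
  rw [hb, hd.deriv]
  simp [hm]
  ring

/-- for `m ≥ 2` and `1 ≤ i, r ≤ m−1`,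
`∫₀¹ B'_{i,m}(u) B'_{r,m}(u) du
  = [C(m,i)C(m,r)/((2m−3)C(2m−4,i+r−2))]·[ir − 2m(m−1)C(i+r,2)/((2m−1)(2m−2))]`. -/
theorem bernstein_deriv_product_integral (m i r : ℕ) (hm : 2 ≤ m)
    (hi : 1 ≤ i) (hi' : i ≤ m - 1) (hr : 1 ≤ r) (hr' : r ≤ m - 1) :
    ∫ u in (0:ℝ)..1, deriv (bern m i) u * deriv (bern m r) u
      = ((m.choose i : ℝ) * (m.choose r : ℝ) /
          ((2 * (m : ℝ) - 3) * ((2 * m - 4).choose (i + r - 2) : ℝ))) *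
        ((i : ℝ) * (r : ℝ) - 2 * (m : ℝ) * ((m : ℝ) - 1) * (((i + r).choose 2 : ℕ) : ℝ) /
          ((2 * (m : ℝ) - 1) * (2 * (m : ℝ) - 2))) := by
  obtain ⟨p, rfl⟩ := Nat.exists_eq_add_of_le' hi
  obtain ⟨q, rfl⟩ := Nat.exists_eq_add_of_le' hr
  obtain ⟨k, hk⟩ : ∃ k, m = p + k + 2 := ⟨m - p - 2, by omega⟩
  obtain ⟨l, hl⟩ : ∃ l, m = q + l + 2 := ⟨m - q - 2, by omega⟩
  have hmab : 2 * (m : ℝ) = p + q + (k + l) + 4 := by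
    have hk' : (m : ℝ) = p + k + 2 := by exact_mod_cast hk
    have hl' : (m : ℝ) = q + l + 2 := by exact_mod_cast hl
    linarith
  have hsplit : ∀ u : ℝ, deriv (bern m (p + 1)) u * deriv (bern m (q + 1)) u
      = ((m.choose (p + 1) : ℝ) * m.choose (q + 1)) *
        (((p : ℝ) + 1) * (q + 1) * (u ^ (p + q) * (1 - u) ^ (k + l))
          - (m : ℝ) * (p + q + 2) * (u ^ (p + q + 1) * (1 - u) ^ (k + l))
          + (m : ℝ) ^ 2 * (u ^ (p + q + 1 + 1) * (1 - u) ^ (k + l))) := by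
    intro u
    rw [deriv_bern_of_eq hk, deriv_bern_of_eq hl]
    ring
  have hn : 2 * m - 4 = p + q + (k + l) := by omega
  have hs : p + 1 + (q + 1) - 2 = p + q := by omega
  simp only [hsplit]
  rw [intervalIntegral.integral_const_mul, intervalIntegral.integral_add
      (Continuous.intervalIntegrable (by fun_prop) _ _)
      (Continuous.intervalIntegrable (by fun_prop) _ _),
    intervalIntegral.integral_sub (Continuous.intervalIntegrable (by fun_prop) _ _)
      (Continuous.intervalIntegrable (by fun_prop) _ _),
    intervalIntegral.integral_const_mul, intervalIntegral.integral_const_mul,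
    intervalIntegral.integral_const_mul, integral_pow_succ_mul_one_sub_pow (p + q + 1),
    integral_pow_succ_mul_one_sub_pow (p + q), integral_pow_mul_one_sub_pow_eq_inv_choose,
    hn, hs, Nat.cast_choose_two]
  have hc : ((p + q + (k + l)).choose (p + q) : ℝ) ≠ 0 := by
    exact_mod_cast (Nat.choose_pos (Nat.le_add_right _ _)).ne'
  push_cast
  have h1 : (p : ℝ) + q + (k + l) + 1 = 2 * m - 3 := by linarith
  have h2 : (p : ℝ) + q + (k + l) + 2 = 2 * m - 2 := by linarith
  have h3 : (p : ℝ) + q + 1 + (k + l) + 2 = 2 * m - 1 := by linarith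
  have hm' : (2 : ℝ) ≤ m := by exact_mod_cast hm
  have h1' : 2 * (m : ℝ) - 3 ≠ 0 := by linarith
  have h2' : 2 * (m : ℝ) - 2 ≠ 0 := by linarith
  have h3' : 2 * (m : ℝ) - 1 ≠ 0 := by linarith
  rw [h1, h2, h3]
  field_simp
  ring
end

section
/- Let m, n ≥ 1 and let Δ be an m×n checkerboard matrix with associated checkerboard copula C_Π^Δ and check–w copula C_↘^Δ. Then ∫_{[0,1]²} ( C_↘^Δ(u,v) − C_Π^Δ(u,v) ) du dv = −1/(12mn). Consequently, Spearman's rho satisfies ρ_S(C_↘^Δ) = ρ_S(C_Π^Δ) − 1/(mn), where ρ_S(C) = 12∫_{[0,1]²} C dλ² − 3. -/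
open MeasureTheory Finset

/-- `Δ` is an m×n checkerboard matrix: nonnegative entries, column sums `1/n`,
row sums `1/m`. -/
def IsCheckerboard (m n : ℕ) (Δ : Matrix (Fin m) (Fin n) ℝ) : Prop :=
  (∀ i j, 0 ≤ Δ i j) ∧ (∀ j, ∑ i, Δ i j = 1 / n) ∧ (∀ i, ∑ j, Δ i j = 1 / m)

/-- Entry access with natural-number (0-based) indices, `0` out of range. -/
noncomputable def cbEntry (m n : ℕ) (Δ : Matrix (Fin m) (Fin n) ℝ) (k l : ℕ) : ℝ :=
  if h : k < m ∧ l < n then Δ ⟨k, h.1⟩ ⟨l, h.2⟩ else 0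

/-- The (0-based) cell index of `u`: `⌊mu⌋`, clamped to `m−1` (so that `u = 1`
belongs to the last cell, realizing the extension with `i = m`). -/
noncomputable def cbIdx (m : ℕ) (u : ℝ) : ℕ := min ⌊(m : ℝ) * u⌋₊ (m - 1)

/-- The checkerboard copula `C_Π^Δ`. -/
noncomputable def checkPi (m n : ℕ) (Δ : Matrix (Fin m) (Fin n) ℝ) (u v : ℝ) : ℝ :=
  (∑ k ∈ Finset.range (cbIdx m u), ∑ l ∈ Finset.range (cbIdx n v), cbEntry m n Δ k l)
  + ((n : ℝ) * v - cbIdx n v) * ∑ k ∈ Finset.range (cbIdx m u), cbEntry m n Δ k (cbIdx n v)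
  + ((m : ℝ) * u - cbIdx m u) * ∑ l ∈ Finset.range (cbIdx n v), cbEntry m n Δ (cbIdx m u) l
  + cbEntry m n Δ (cbIdx m u) (cbIdx n v) * ((m : ℝ) * u - cbIdx m u) * ((n : ℝ) * v - cbIdx n v)

/-- The check–w copula `C_↘^Δ`, with the last term of the checkerboard formula
replaced by `Δᵢⱼ · max{nv−j+mu−i+1, 0}`. -/
noncomputable def checkW (m n : ℕ) (Δ : Matrix (Fin m) (Fin n) ℝ) (u v : ℝ) : ℝ :=
  (∑ k ∈ Finset.range (cbIdx m u), ∑ l ∈ Finset.range (cbIdx n v), cbEntry m n Δ k l)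
  + ((n : ℝ) * v - cbIdx n v) * ∑ k ∈ Finset.range (cbIdx m u), cbEntry m n Δ k (cbIdx n v)
  + ((m : ℝ) * u - cbIdx m u) * ∑ l ∈ Finset.range (cbIdx n v), cbEntry m n Δ (cbIdx m u) l
  + cbEntry m n Δ (cbIdx m u) (cbIdx n v) *
      max (((n : ℝ) * v - cbIdx n v) + ((m : ℝ) * u - cbIdx m u) - 1) 0

theorem cbIdx_eq_of_mem_Ioo {m k : ℕ} (hk : k < m) {u : ℝ}
    (hu : u ∈ Set.Ioo ((k : ℝ) / m) (((k + 1 : ℕ) : ℝ) / m)) : cbIdx m u = k := by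
  have hm : (0 : ℝ) < m := by exact_mod_cast (Nat.zero_le k).trans_lt hk
  obtain ⟨h1, h2⟩ := hu
  rw [div_lt_iff₀ hm] at h1
  rw [lt_div_iff₀ hm] at h2
  push_cast at h2
  have hfloor : ⌊(m : ℝ) * u⌋₊ = k := by
    rw [Nat.floor_eq_iff (by nlinarith [(Nat.cast_nonneg k : (0 : ℝ) ≤ k)])]
    constructor <;> linarith
  rw [cbIdx, hfloor]
  omega

section CellIntegrals

variable {m : ℕ} {F : ℕ → ℝ → ℝ}

theorem ae_restrict_cell_eq {k : ℕ} (hk : k < m) (F : ℕ → ℝ → ℝ) :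
    ∀ᵐ u ∂volume, u ∈ Set.uIoc ((k : ℝ) / m) (((k + 1 : ℕ) : ℝ) / m) →
      F k (m * u - k) = F (cbIdx m u) (m * u - cbIdx m u) := by
  have hle : (k : ℝ) / m ≤ ((k + 1 : ℕ) : ℝ) / m := by
    gcongr
    omega
  filter_upwards [Measure.ae_ne volume (((k + 1 : ℕ) : ℝ) / m)] with u hne hu
  rw [Set.uIoc_of_le hle] at hu
  rw [cbIdx_eq_of_mem_Ioo hk ⟨hu.1, lt_of_le_of_ne hu.2 hne⟩]

theorem intervalIntegrable_cell (hF : ∀ k, Continuous (F k)) {k : ℕ} (hk : k < m) :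
    IntervalIntegrable (fun u => F (cbIdx m u) (m * u - cbIdx m u)) volume
      ((k : ℝ) / m) (((k + 1 : ℕ) : ℝ) / m) := by
  have hc : Continuous fun u : ℝ => F k (m * u - k) := (hF k).comp (by fun_prop)
  refine (hc.intervalIntegrable _ _).congr_ae ?_
  exact (ae_restrict_iff' measurableSet_uIoc).2 (ae_restrict_cell_eq hk F)

theorem intervalIntegrable_cbIdx (hm : 1 ≤ m) (hF : ∀ k, Continuous (F k)) :
    IntervalIntegrable (fun u => F (cbIdx m u) (m * u - cbIdx m u)) volume 0 1 := by
  have h := IntervalIntegrable.trans_iterate (a := fun k : ℕ => (k : ℝ) / m)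
    fun k hk => intervalIntegrable_cell hF (k := k) hk
  have hm0 : (m : ℝ) ≠ 0 := by positivity
  simpa [hm0] using h

theorem integral_cbIdx (hm : 1 ≤ m) (hF : ∀ k, Continuous (F k)) :
    ∫ u in (0 : ℝ)..1, F (cbIdx m u) (m * u - cbIdx m u)
      = (m : ℝ)⁻¹ * ∑ k ∈ range m, ∫ t in (0 : ℝ)..1, F k t := by
  have hm0 : (m : ℝ) ≠ 0 := by positivity
  have h := intervalIntegral.sum_integral_adjacent_intervals (a := fun k : ℕ => (k : ℝ) / m)
    fun k hk => intervalIntegrable_cell hF (k := k) hk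
  simp only [Nat.cast_zero, zero_div, div_self hm0] at h
  rw [← h, mul_sum]
  refine sum_congr rfl fun k hk => ?_
  rw [← intervalIntegral.integral_congr_ae (ae_restrict_cell_eq (mem_range.1 hk) F),
    intervalIntegral.integral_comp_mul_sub _ hm0, smul_eq_mul,
    mul_div_cancel₀ _ hm0, mul_div_cancel₀ _ hm0]
  simp

end CellIntegrals

section DoubleCellIntegrals

variable {m n : ℕ} {H : ℕ → ℕ → ℝ → ℝ → ℝ}

theorem continuous_integral_cell (hH : ∀ i j, Continuous fun p : ℝ × ℝ => H i j p.1 p.2)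
    (i : ℕ) :
    Continuous fun s => (n : ℝ)⁻¹ * ∑ j ∈ range n, ∫ t in (0 : ℝ)..1, H i j s t :=
  continuous_const.mul <| continuous_finsetSum _ fun j _ =>
    intervalIntegral.continuous_parametric_intervalIntegral_of_continuous' (hH i j) 0 1

theorem integral_cbIdx_right (hn : 1 ≤ n)
    (hH : ∀ i j, Continuous fun p : ℝ × ℝ => H i j p.1 p.2) (i : ℕ) (s : ℝ) :
    ∫ v in (0 : ℝ)..1, H i (cbIdx n v) s (n * v - cbIdx n v)
      = (n : ℝ)⁻¹ * ∑ j ∈ range n, ∫ t in (0 : ℝ)..1, H i j s t :=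
  integral_cbIdx (F := fun j t => H i j s t) hn fun j =>
    (hH i j).comp (by fun_prop : Continuous fun t : ℝ => (s, t))

theorem intervalIntegrable_cbIdx_right (hn : 1 ≤ n)
    (hH : ∀ i j, Continuous fun p : ℝ × ℝ => H i j p.1 p.2) (i : ℕ) (s : ℝ) :
    IntervalIntegrable (fun v => H i (cbIdx n v) s (n * v - cbIdx n v)) volume 0 1 :=
  intervalIntegrable_cbIdx (F := fun j t => H i j s t) hn fun j =>
    (hH i j).comp (by fun_prop : Continuous fun t : ℝ => (s, t))

theorem intervalIntegrable_integral_cbIdx (hm : 1 ≤ m) (hn : 1 ≤ n)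
    (hH : ∀ i j, Continuous fun p : ℝ × ℝ => H i j p.1 p.2) :
    IntervalIntegrable (fun u => ∫ v in (0 : ℝ)..1,
      H (cbIdx m u) (cbIdx n v) (m * u - cbIdx m u) (n * v - cbIdx n v)) volume 0 1 := by
  simp only [integral_cbIdx_right hn hH]
  exact intervalIntegrable_cbIdx
    (F := fun i s => (n : ℝ)⁻¹ * ∑ j ∈ range n, ∫ t in (0 : ℝ)..1, H i j s t) hm
    (continuous_integral_cell hH)

theorem integral_integral_cbIdx (hm : 1 ≤ m) (hn : 1 ≤ n)
    (hH : ∀ i j, Continuous fun p : ℝ × ℝ => H i j p.1 p.2) :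
    ∫ u in (0 : ℝ)..1, ∫ v in (0 : ℝ)..1,
        H (cbIdx m u) (cbIdx n v) (m * u - cbIdx m u) (n * v - cbIdx n v)
      = (m : ℝ)⁻¹ * ∑ i ∈ range m, (n : ℝ)⁻¹ *
          ∑ j ∈ range n, ∫ s in (0 : ℝ)..1, ∫ t in (0 : ℝ)..1, H i j s t := by
  simp only [integral_cbIdx_right hn hH]
  rw [integral_cbIdx
    (F := fun i s => (n : ℝ)⁻¹ * ∑ j ∈ range n, ∫ t in (0 : ℝ)..1, H i j s t) hm
    (continuous_integral_cell hH)]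
  congr 1
  refine sum_congr rfl fun i _ => ?_
  rw [intervalIntegral.integral_const_mul, intervalIntegral.integral_finsetSum]
  exact fun j _ => (intervalIntegral.continuous_parametric_intervalIntegral_of_continuous'
    (hH i j) 0 1).intervalIntegrable _ _

end DoubleCellIntegrals

theorem integral_max_add_sub_one {s : ℝ} (hs : s ∈ Set.Icc (0 : ℝ) 1) :
    ∫ t in (0 : ℝ)..1, max (t + s - 1) 0 = s ^ 2 / 2 := by
  obtain ⟨h0, h1⟩ := hs
  have hc : Continuous fun t : ℝ => max (t + s - 1) 0 := by fun_prop
  have hleft : ∫ t in (0 : ℝ)..(1 - s), max (t + s - 1) 0 = ∫ t in (0 : ℝ)..(1 - s), (0 : ℝ) := by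
    refine intervalIntegral.integral_congr fun t ht => ?_
    rw [Set.uIcc_of_le (by linarith)] at ht
    exact max_eq_right (by linarith [ht.2])
  have hright : ∫ t in (1 - s)..1, max (t + s - 1) 0 = ∫ t in (1 - s)..1, (t - (1 - s)) := by
    refine intervalIntegral.integral_congr fun t ht => ?_
    rw [Set.uIcc_of_le (by linarith)] at ht
    exact (max_eq_left (by linarith [ht.1])).trans (by ring)
  rw [← intervalIntegral.integral_add_adjacent_intervals
    (hc.intervalIntegrable 0 (1 - s)) (hc.intervalIntegrable (1 - s) 1), hleft, hright,
    intervalIntegral.integral_sub (by simp) (by simp)]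
  simp
  ring

theorem integral_integral_max_sub_mul :
    ∫ s in (0 : ℝ)..1, ∫ t in (0 : ℝ)..1, (max (t + s - 1) 0 - s * t) = -(1 / 12) := by
  have hinner : ∀ s ∈ Set.uIcc (0 : ℝ) 1,
      ∫ t in (0 : ℝ)..1, (max (t + s - 1) 0 - s * t) = s ^ 2 / 2 - s / 2 := by
    intro s hs
    rw [Set.uIcc_of_le zero_le_one] at hs
    rw [intervalIntegral.integral_sub
      ((by fun_prop : Continuous fun t : ℝ => max (t + s - 1) 0).intervalIntegrable _ _)
      ((by fun_prop : Continuous fun t : ℝ => s * t).intervalIntegrable _ _),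
      integral_max_add_sub_one hs, intervalIntegral.integral_const_mul, integral_id]
    ring
  rw [intervalIntegral.integral_congr hinner, intervalIntegral.integral_sub
      ((by fun_prop : Continuous fun s : ℝ => s ^ 2 / 2).intervalIntegrable _ _)
      ((by fun_prop : Continuous fun s : ℝ => s / 2).intervalIntegrable _ _),
    intervalIntegral.integral_div, intervalIntegral.integral_div, integral_id, integral_pow]
  norm_num

theorem IsCheckerboard.sum_cbEntry {m n : ℕ} {Δ : Matrix (Fin m) (Fin n) ℝ}
    (hΔ : IsCheckerboard m n Δ) (hm : 1 ≤ m) :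
    ∑ i ∈ range m, ∑ j ∈ range n, cbEntry m n Δ i j = 1 := by
  have hm0 : (m : ℝ) ≠ 0 := by positivity
  simp [Finset.sum_range, cbEntry, hΔ.2.2, hm0]

/-- The part of a checkerboard-type copula on the cell `(i, j)` that is affine in each local
coordinate and common to `checkPi` and `checkW`. -/
noncomputable def cellBase (m n : ℕ) (Δ : Matrix (Fin m) (Fin n) ℝ) (i j : ℕ) (s t : ℝ) : ℝ :=
  (∑ k ∈ range i, ∑ l ∈ range j, cbEntry m n Δ k l)
  + t * ∑ k ∈ range i, cbEntry m n Δ k j + s * ∑ l ∈ range j, cbEntry m n Δ i l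

theorem continuous_cellBase (m n : ℕ) (Δ : Matrix (Fin m) (Fin n) ℝ) (i j : ℕ) :
    Continuous fun p : ℝ × ℝ => cellBase m n Δ i j p.1 p.2 := by
  unfold cellBase
  fun_prop

theorem integral_integral_checkW_sub_checkPi {m n : ℕ} (hm : 1 ≤ m) (hn : 1 ≤ n)
    {Δ : Matrix (Fin m) (Fin n) ℝ} (hΔ : IsCheckerboard m n Δ) :
    ∫ u in (0 : ℝ)..1, ∫ v in (0 : ℝ)..1, (checkW m n Δ u v - checkPi m n Δ u v)
      = -(1 / (12 * (m : ℝ) * n)) := by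
  have hcell (u v : ℝ) : checkW m n Δ u v - checkPi m n Δ u v =
      (fun (i j : ℕ) (s t : ℝ) => cbEntry m n Δ i j * (max (t + s - 1) 0 - s * t))
        (cbIdx m u) (cbIdx n v) (m * u - cbIdx m u) (n * v - cbIdx n v) := by
    simp only [checkW, checkPi]
    ring
  simp only [hcell]
  rw [integral_integral_cbIdx
    (H := fun (i j : ℕ) (s t : ℝ) => cbEntry m n Δ i j * (max (t + s - 1) 0 - s * t))
    hm hn fun i j => by fun_prop]
  simp only [intervalIntegral.integral_const_mul, integral_integral_max_sub_mul, ← sum_mul,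
    ← mul_sum, hΔ.sum_cbEntry hm]
  field_simp

theorem integral_integral_checkW_sub {m n : ℕ} (hm : 1 ≤ m) (hn : 1 ≤ n)
    (Δ : Matrix (Fin m) (Fin n) ℝ) :
    ∫ u in (0 : ℝ)..1, ∫ v in (0 : ℝ)..1, (checkW m n Δ u v - checkPi m n Δ u v)
      = (∫ u in (0 : ℝ)..1, ∫ v in (0 : ℝ)..1, checkW m n Δ u v)
        - ∫ u in (0 : ℝ)..1, ∫ v in (0 : ℝ)..1, checkPi m n Δ u v := by
  have hW : ∀ i j, Continuous fun p : ℝ × ℝ =>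
      cellBase m n Δ i j p.1 p.2 + cbEntry m n Δ i j * max (p.2 + p.1 - 1) 0 :=
    fun i j => (continuous_cellBase m n Δ i j).add (by fun_prop)
  have hP : ∀ i j, Continuous fun p : ℝ × ℝ =>
      cellBase m n Δ i j p.1 p.2 + cbEntry m n Δ i j * p.1 * p.2 :=
    fun i j => (continuous_cellBase m n Δ i j).add (by fun_prop)
  have hWu : IntervalIntegrable (fun u => ∫ v in (0 : ℝ)..1, checkW m n Δ u v) volume 0 1 :=
    intervalIntegrable_integral_cbIdx (H := fun i j s t =>
      cellBase m n Δ i j s t + cbEntry m n Δ i j * max (t + s - 1) 0) hm hn hW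
  have hPu : IntervalIntegrable (fun u => ∫ v in (0 : ℝ)..1, checkPi m n Δ u v) volume 0 1 :=
    intervalIntegrable_integral_cbIdx (H := fun i j s t =>
      cellBase m n Δ i j s t + cbEntry m n Δ i j * s * t) hm hn hP
  rw [← intervalIntegral.integral_sub hWu hPu]
  refine intervalIntegral.integral_congr fun u _ => ?_
  exact intervalIntegral.integral_sub
    (intervalIntegrable_cbIdx_right (H := fun i j s t =>
      cellBase m n Δ i j s t + cbEntry m n Δ i j * max (t + s - 1) 0) hn hW _ _)
    (intervalIntegrable_cbIdx_right (H := fun i j s t =>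
      cellBase m n Δ i j s t + cbEntry m n Δ i j * s * t) hn hP _ _)

/-- `∫_{[0,1]²} (C_↘^Δ − C_Π^Δ) = −1/(12mn)`, and consequently
`ρ_S(C_↘^Δ) = ρ_S(C_Π^Δ) − 1/(mn)` where `ρ_S(C) = 12∫C − 3`. -/
theorem checkw_spearman_rho (m n : ℕ) (hm : 1 ≤ m) (hn : 1 ≤ n)
    (Δ : Matrix (Fin m) (Fin n) ℝ) (hΔ : IsCheckerboard m n Δ) :
    (∫ u in (0:ℝ)..1, ∫ v in (0:ℝ)..1, (checkW m n Δ u v - checkPi m n Δ u v))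
      = - (1 / (12 * (m : ℝ) * n)) ∧
    12 * (∫ u in (0:ℝ)..1, ∫ v in (0:ℝ)..1, checkW m n Δ u v) - 3
      = (12 * (∫ u in (0:ℝ)..1, ∫ v in (0:ℝ)..1, checkPi m n Δ u v) - 3)
          - 1 / ((m : ℝ) * n) := by
  have hdiff := integral_integral_checkW_sub_checkPi hm hn hΔ
  refine ⟨hdiff, ?_⟩
  rw [integral_integral_checkW_sub hm hn Δ] at hdiff
  have h12 : 1 / ((m : ℝ) * n) = 12 * (1 / (12 * (m : ℝ) * n)) := by field_simp
  linarith
end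

section
/- Let m, n ≥ 1 and let Δ be an m×n checkerboard matrix. Define p↗ : [0,1)² → ℝ by p↗(u,v) = m·( ∑_{l=1}^{j−1} Δ_{i,l} + Δ_{i,j}·1{nv−j+1 ≥ mu−i+1} ) for (u,v) ∈ I_{i,j} (this is the a.e. partial derivative ∂₁C_↗^Δ of the check–min copula). Then ∫_{[0,1]²} p↗(u,v)² du dv = (m/n) ∑_{i=1}^{m} ∑_{j=1}^{n} [ ( ∑_{l=1}^{j−1} Δ_{i,l} )² + ( ∑_{l=1}^{j−1} Δ_{i,l} )·Δ_{i,j} + (1/2)·Δ_{i,j}² ]. Consequently, Chatterjee's xi satisfies ξ(C_↗^Δ) = ξ(C_Π^Δ) + (m/n)·tr(Δᵀ Δ), where ξ(C_Π^Δ) = (6m/n)·∑_{i,j}[ (∑_{l<j}Δ_{i,l})² + (∑_{l<j}Δ_{i,l})Δ_{i,j} + Δ_{i,j}²/3 ] − 2 is Chatterjee's xi of the checkerboard copula. -/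
open MeasureTheory Finset

/-- The a.e. partial derivative `∂₁C_↗^Δ` of the check–min copula:
`p↗(u,v) = m(∑_{l<j} Δᵢₗ + Δᵢⱼ·1{nv−j+1 ≥ mu−i+1})` on cell `Iᵢⱼ`. -/
noncomputable def pMin (m n : ℕ) (Δ : Matrix (Fin m) (Fin n) ℝ) (u v : ℝ) : ℝ :=
  (m : ℝ) * ((∑ l ∈ Finset.range (cbIdx n v), cbEntry m n Δ (cbIdx m u) l)
    + cbEntry m n Δ (cbIdx m u) (cbIdx n v) *
        (if (m : ℝ) * u - cbIdx m u ≤ (n : ℝ) * v - cbIdx n v then 1 else 0))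

/-- On the `k`-th cell the index function is constantly `k`. -/
lemma cbIdx_eq_of_mem_Ioo_s16 {n k : ℕ} (hk : k < n) {v : ℝ}
    (hv : v ∈ Set.Ioo ((k : ℝ) / n) ((k + 1 : ℕ) / (n : ℝ))) : cbIdx n v = k := by
  have hn : (0 : ℝ) < n := by exact_mod_cast (Nat.zero_le k).trans_lt hk
  obtain ⟨h₁, h₂⟩ := hv
  rw [div_lt_iff₀ hn] at h₁
  rw [lt_div_iff₀ hn] at h₂
  push_cast at h₂
  have hfloor : ⌊(n : ℝ) * v⌋₊ = k := by
    have hk0 : (0 : ℝ) ≤ k := k.cast_nonneg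
    rw [Nat.floor_eq_iff (by linarith)]
    constructor <;> linarith
  rw [cbIdx, hfloor]
  omega

/-- Integrating over `[0,1]` a function of the cell index and of the relative position in the
cell amounts to averaging, over the cells, the integrals in the relative position. -/
lemma integral_cbIdx_s16 {n : ℕ} (hn : 1 ≤ n) (F : ℕ → ℝ → ℝ)
    (hF : ∀ k < n, IntervalIntegrable (F k) volume 0 1) :
    ∫ v in (0 : ℝ)..1, F (cbIdx n v) ((n : ℝ) * v - cbIdx n v)
      = (n : ℝ)⁻¹ * ∑ k ∈ Finset.range n, ∫ s in (0 : ℝ)..1, F k s := by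
  have hn0 : (n : ℝ) ≠ 0 := by
    have : n ≠ 0 := by omega
    exact_mod_cast this
  have hle (k : ℕ) : (k : ℝ) / n ≤ (k + 1 : ℕ) / (n : ℝ) := by
    gcongr
    exact k.le_succ
  have hcongr (k : ℕ) (hk : k < n) :
      Set.EqOn (fun v : ℝ => F k ((n : ℝ) * v - k))
        (fun v : ℝ => F (cbIdx n v) ((n : ℝ) * v - cbIdx n v))
        (Set.Ioo ((k : ℝ) / n) ((k + 1 : ℕ) / (n : ℝ))) := by
    intro v hv
    simp only [cbIdx_eq_of_mem_Ioo_s16 hk hv]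
  have hae (k : ℕ) (hk : k < n) :
      (fun v : ℝ => F k ((n : ℝ) * v - k)) =ᵐ[volume.restrict
          (Set.uIoc ((k : ℝ) / n) ((k + 1 : ℕ) / (n : ℝ)))]
        (fun v : ℝ => F (cbIdx n v) ((n : ℝ) * v - cbIdx n v)) := by
    rw [Set.uIoc_of_le (hle k), ← restrict_Ioo_eq_restrict_Ioc]
    exact (ae_restrict_mem measurableSet_Ioo).mono (hcongr k hk)
  have hint (k : ℕ) (hk : k < n) :
      IntervalIntegrable (fun v : ℝ => F k ((n : ℝ) * v - k)) volume
        ((k : ℝ) / n) ((k + 1 : ℕ) / (n : ℝ)) := by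
    have h := ((hF k hk).comp_sub_right (k : ℝ)).comp_mul_left (c := (n : ℝ))
    simpa [add_comm] using h
  have hsum := intervalIntegral.sum_integral_adjacent_intervals
    (f := fun v : ℝ => F (cbIdx n v) ((n : ℝ) * v - cbIdx n v)) (μ := volume)
    (a := fun k : ℕ => (k : ℝ) / n) (n := n)
    (fun k hk => (hint k hk).congr_ae (hae k hk))
  simp only [Nat.cast_zero, zero_div, div_self hn0] at hsum
  rw [← hsum, Finset.mul_sum]
  refine Finset.sum_congr rfl fun k hk => ?_
  have hk' : k < n := Finset.mem_range.mp hk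
  rw [← intervalIntegral.integral_congr_ae_restrict (hae k hk'),
    intervalIntegral.integral_comp_mul_sub (fun s => F k s) hn0]
  have h₁ : (n : ℝ) * (k / n) - k = 0 := by field_simp; ring
  have h₂ : (n : ℝ) * ((k + 1 : ℕ) / n) - k = 1 := by push_cast; field_simp; ring
  rw [h₁, h₂, smul_eq_mul]

lemma monotone_ite_le (t : ℝ) : Monotone fun s : ℝ => if t ≤ s then (1 : ℝ) else 0 := by
  intro x y hxy
  dsimp only
  split_ifs <;> linarith

lemma integral_ite_le {t : ℝ} (ht : t ∈ Set.Icc (0 : ℝ) 1) :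
    ∫ s in (0 : ℝ)..1, (if t ≤ s then (1 : ℝ) else 0) = 1 - t := by
  have hi (a b : ℝ) := (monotone_ite_le t).intervalIntegrable (μ := volume) (a := a) (b := b)
  rw [← intervalIntegral.integral_add_adjacent_intervals (hi 0 t) (hi t 1)]
  have h₁ : ∫ s in (0 : ℝ)..t, (if t ≤ s then (1 : ℝ) else 0) = ∫ _ in (0 : ℝ)..t, (0 : ℝ) := by
    refine intervalIntegral.integral_congr_Ioo_of_le ht.1 fun s hs => ?_
    exact if_neg (not_le.mpr hs.2)
  have h₂ : ∫ s in t..1, (if t ≤ s then (1 : ℝ) else 0) = ∫ _ in t..1, (1 : ℝ) := by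
    refine intervalIntegral.integral_congr_Ioo_of_le ht.2 fun s hs => ?_
    exact if_pos hs.1.le
  simp [h₁, h₂]

lemma sq_mul_add_mul_ite (c a b : ℝ) (p : Prop) [Decidable p] :
    (c * (a + b * if p then 1 else 0)) ^ 2
      = c ^ 2 * a ^ 2 + c ^ 2 * (2 * a * b + b ^ 2) * if p then 1 else 0 := by
  split_ifs <;> ring

lemma intervalIntegrable_sq_ite (c a b t : ℝ) :
    IntervalIntegrable (fun s : ℝ => (c * (a + b * if t ≤ s then 1 else 0)) ^ 2) volume 0 1 := by
  simp only [sq_mul_add_mul_ite]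
  exact intervalIntegrable_const.add ((monotone_ite_le t).intervalIntegrable.const_mul _)

lemma integral_sq_ite (c a b : ℝ) {t : ℝ} (ht : t ∈ Set.Icc (0 : ℝ) 1) :
    ∫ s in (0 : ℝ)..1, (c * (a + b * if t ≤ s then 1 else 0)) ^ 2
      = c ^ 2 * (a ^ 2 + (2 * a * b + b ^ 2) * (1 - t)) := by
  simp only [sq_mul_add_mul_ite]
  rw [intervalIntegral.integral_add intervalIntegrable_const
      ((monotone_ite_le t).intervalIntegrable.const_mul _),
    intervalIntegral.integral_const_mul (c ^ 2 * (2 * a * b + b ^ 2)), integral_ite_le ht]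
  simp only [intervalIntegral.integral_const, smul_eq_mul]
  ring

lemma integral_sq_add_mul_one_sub (c a b : ℝ) :
    ∫ t in (0 : ℝ)..1, c ^ 2 * (a ^ 2 + (2 * a * b + b ^ 2) * (1 - t))
      = c ^ 2 * (a ^ 2 + a * b + 1 / 2 * b ^ 2) := by
  rw [intervalIntegral.integral_const_mul, intervalIntegral.integral_add
      intervalIntegrable_const (Continuous.intervalIntegrable (by fun_prop) _ _),
    intervalIntegral.integral_const_mul, intervalIntegral.integral_sub
      intervalIntegrable_const (Continuous.intervalIntegrable (by fun_prop) _ _)]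
  simp only [intervalIntegral.integral_const, integral_id, smul_eq_mul]
  ring

/-- The squared partial derivative, integrated over `[0,1]²`, with natural-number indices. -/
lemma integral_pMin_sq {m n : ℕ} (hm : 1 ≤ m) (hn : 1 ≤ n) (Δ : Matrix (Fin m) (Fin n) ℝ) :
    ∫ u in (0 : ℝ)..1, ∫ v in (0 : ℝ)..1, (pMin m n Δ u v) ^ 2
      = ((m : ℝ) / n) * ∑ i ∈ Finset.range m, ∑ j ∈ Finset.range n,
          ((∑ l ∈ Finset.range j, cbEntry m n Δ i l) ^ 2
            + (∑ l ∈ Finset.range j, cbEntry m n Δ i l) * cbEntry m n Δ i j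
            + (1 / 2) * (cbEntry m n Δ i j) ^ 2) := by
  let D : ℕ → ℕ → ℝ := cbEntry m n Δ
  let S : ℕ → ℕ → ℝ := fun i j => ∑ l ∈ Finset.range j, D i l
  change _ = ((m : ℝ) / n) * ∑ i ∈ Finset.range m, ∑ j ∈ Finset.range n,
    (S i j ^ 2 + S i j * D i j + 1 / 2 * D i j ^ 2)
  have hinner (u : ℝ) : ∫ v in (0 : ℝ)..1, (pMin m n Δ u v) ^ 2
      = (n : ℝ)⁻¹ * ∑ j ∈ Finset.range n, ∫ s in (0 : ℝ)..1,
          ((m : ℝ) * (S (cbIdx m u) j + D (cbIdx m u) j *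
            if (m : ℝ) * u - cbIdx m u ≤ s then 1 else 0)) ^ 2 :=
    integral_cbIdx_s16 hn (fun j s => ((m : ℝ) * (S (cbIdx m u) j + D (cbIdx m u) j *
        if (m : ℝ) * u - cbIdx m u ≤ s then 1 else 0)) ^ 2)
      fun _ _ => intervalIntegrable_sq_ite _ _ _ _
  set G : ℕ → ℝ → ℝ := fun i t => (n : ℝ)⁻¹ * ∑ j ∈ Finset.range n, ∫ s in (0 : ℝ)..1,
    ((m : ℝ) * (S i j + D i j * if t ≤ s then 1 else 0)) ^ 2 with hG
  set H : ℕ → ℝ → ℝ := fun i t => (n : ℝ)⁻¹ * ∑ j ∈ Finset.range n,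
    (m : ℝ) ^ 2 * (S i j ^ 2 + (2 * S i j * D i j + D i j ^ 2) * (1 - t)) with hH
  have hGH (i : ℕ) : Set.EqOn (H i) (G i) (Set.uIcc 0 1) := by
    intro t ht
    rw [Set.uIcc_of_le zero_le_one] at ht
    simp only [hG, hH, integral_sq_ite _ _ _ ht]
  have hHcont (i : ℕ) : Continuous (H i) := by fun_prop
  have hGint (i : ℕ) : IntervalIntegrable (G i) volume 0 1 :=
    ((hHcont i).intervalIntegrable 0 1).congr
      fun t ht => hGH i (Set.uIoc_subset_uIcc ht)
  have houter : ∫ u in (0 : ℝ)..1, ∫ v in (0 : ℝ)..1, (pMin m n Δ u v) ^ 2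
      = ∫ u in (0 : ℝ)..1, G (cbIdx m u) ((m : ℝ) * u - cbIdx m u) := by
    simp only [hinner, hG]
  rw [houter, integral_cbIdx_s16 hm G fun i _ => hGint i]
  have hGval (i : ℕ) : ∫ t in (0 : ℝ)..1, G i t = (n : ℝ)⁻¹ * ∑ j ∈ Finset.range n,
      (m : ℝ) ^ 2 * (S i j ^ 2 + S i j * D i j + 1 / 2 * D i j ^ 2) := by
    rw [← intervalIntegral.integral_congr (hGH i), intervalIntegral.integral_const_mul,
      intervalIntegral.integral_finsetSum
        fun j _ => Continuous.intervalIntegrable (by fun_prop) _ _]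
    simp only [integral_sq_add_mul_one_sub]
  have hm0 : (m : ℝ) ≠ 0 := by
    have : m ≠ 0 := by omega
    exact_mod_cast this
  simp only [hGval, ← Finset.mul_sum]
  rw [← mul_assoc, ← mul_assoc]
  congr 1
  field_simp

lemma cbEntry_fin {m n : ℕ} (Δ : Matrix (Fin m) (Fin n) ℝ) (i : Fin m) (j : Fin n) :
    cbEntry m n Δ i j = Δ i j := by
  simp [cbEntry]

lemma sum_range_cbEntry {m n : ℕ} (Δ : Matrix (Fin m) (Fin n) ℝ) (i : Fin m) (j : Fin n) :
    ∑ l ∈ Finset.range j, cbEntry m n Δ i l = ∑ l ∈ Finset.Iio j, Δ i l := by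
  rw [← Nat.Iio_eq_range, ← Fin.map_valEmbedding_Iio, Finset.sum_map]
  exact Finset.sum_congr rfl fun l _ => cbEntry_fin Δ i l

lemma trace_transpose_mul_self {m n : ℕ} (Δ : Matrix (Fin m) (Fin n) ℝ) :
    Matrix.trace (Δ.transpose * Δ) = ∑ i, ∑ j, (Δ i j) ^ 2 := by
  simp only [Matrix.trace, Matrix.diag_apply, Matrix.mul_apply, Matrix.transpose_apply, sq]
  exact Finset.sum_comm

/-- `∫_{[0,1]²} p↗² = (m/n) ∑ᵢⱼ [(∑_{l<j}Δᵢₗ)² + (∑_{l<j}Δᵢₗ)Δᵢⱼ + Δᵢⱼ²/2]`,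
and consequently `ξ(C_↗^Δ) = 6∫p↗² − 2 = ξ(C_Π^Δ) + (m/n) tr(Δᵀ Δ)`, where
`ξ(C_Π^Δ) = (6m/n) ∑ᵢⱼ [(∑_{l<j}Δᵢₗ)² + (∑_{l<j}Δᵢₗ)Δᵢⱼ + Δᵢⱼ²/3] − 2`. -/
theorem checkmin_chatterjee_xi (m n : ℕ) (hm : 1 ≤ m) (hn : 1 ≤ n)
    (Δ : Matrix (Fin m) (Fin n) ℝ) (hΔ : IsCheckerboard m n Δ) :
    (∫ u in (0:ℝ)..1, ∫ v in (0:ℝ)..1, (pMin m n Δ u v) ^ 2)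
      = ((m : ℝ) / n) * ∑ i : Fin m, ∑ j : Fin n,
          ((∑ l ∈ Finset.Iio j, Δ i l) ^ 2 + (∑ l ∈ Finset.Iio j, Δ i l) * Δ i j
            + (1 / 2) * (Δ i j) ^ 2) ∧
    6 * (∫ u in (0:ℝ)..1, ∫ v in (0:ℝ)..1, (pMin m n Δ u v) ^ 2) - 2
      = ((6 * (m : ℝ) / n) * (∑ i : Fin m, ∑ j : Fin n,
          ((∑ l ∈ Finset.Iio j, Δ i l) ^ 2 + (∑ l ∈ Finset.Iio j, Δ i l) * Δ i j
            + (1 / 3) * (Δ i j) ^ 2)) - 2)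
        + ((m : ℝ) / n) * Matrix.trace (Δ.transpose * Δ) := by
  have key : (∫ u in (0:ℝ)..1, ∫ v in (0:ℝ)..1, (pMin m n Δ u v) ^ 2)
      = ((m : ℝ) / n) * ∑ i : Fin m, ∑ j : Fin n,
          ((∑ l ∈ Finset.Iio j, Δ i l) ^ 2 + (∑ l ∈ Finset.Iio j, Δ i l) * Δ i j
            + (1 / 2) * (Δ i j) ^ 2) := by
    rw [integral_pMin_sq hm hn]
    rw [Finset.sum_range]
    simp only [Finset.sum_range fun j => _ + _ * _ + _ * _, sum_range_cbEntry, cbEntry_fin]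
  refine ⟨key, ?_⟩
  rw [key, trace_transpose_mul_self]
  simp only [Finset.sum_add_distrib, ← Finset.mul_sum]
  ring
end
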